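/- Let K be an invertible symmetric positive-definite n×n matrix with nonnegative integer entries and let (Q^(k), a^(k), b^(k)), k = 0, …, L−1, be a Durfee system for K. Let q ∈ (0,1) be real and let z₁, …, z_n be positive reals. For a symmetric positive-definite rational n×n matrix A and Q̃ ∈ ℚ^n define Z_∞(A; Q̃ | z; q) := Σ_{m ∈ (ℤ≥0)^n} (∏_i z_i^{m_i}) q^{(1/2) m·A·m + Q̃·m} / ∏_i (q;q)_{m_i} (an absolutely convergent series). Set Q'^(k) := −K^{−1}·Q^(k) and z'_i := ∏_j z_j^{−K_{ij}}. Then Σ_{k=0}^{L−1} (∏_i z_i^{−Q^(k)_i}) q^{(1/2) Q^(k)·K^{−1}·Q^(k) + a^(k)·b^(k)} · Z_∞(K; Q^(k)+b^(k) | z'; q) · Z_∞(K^{−1}; Q'^(k)+a^(k) | z; q) = (∏_{j≥1} (1−q^j))^{−n} · Σ_{p ∈ ℤ^n} (∏_i z_i^{p_i}) q^{(1/2) p·K^{−1}·p}, where the series on the right converges absolutely since K^{−1} is positive definite. -/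

import Mathlib

open Matrix

noncomputable section

/-- The field of rational functions `ℚ(q, z₁, …, z_n)`; the variable indexed by `none`
plays the role of `q` and the variable indexed by `some i` plays the role of `z i`. -/
abbrev FF (n : ℕ) := FractionRing (MvPolynomial (Option (Fin n)) ℚ)

/-- The indeterminate `q`. -/
def qv (n : ℕ) : FF n :=
  algebraMap (MvPolynomial (Option (Fin n)) ℚ) (FF n) (MvPolynomial.X (none : Option (Fin n)))

/-- The indeterminates `z i`. -/
def zv (n : ℕ) (i : Fin n) : FF n :=
  algebraMap (MvPolynomial (Option (Fin n)) ℚ) (FF n) (MvPolynomial.X (some i))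

/-- The q-Pochhammer symbol `(z; q)_M = ∏_{k=1}^M (1 - z q^{k-1})`. -/
def qPoch {F : Type*} [CommRing F] (q z : F) (M : ℕ) : F :=
  ∏ k ∈ Finset.range M, (1 - z * q ^ k)

/-- The q-binomial `[x choose y]_q = (q;q)_x / ((q;q)_y (q;q)_{x-y})` for `0 ≤ y ≤ x`,
and `0` otherwise. -/
def qBinom {F : Type*} [Field F] (q : F) (x y : ℤ) : F :=
  if 0 ≤ y ∧ y ≤ x then qPoch q q x.toNat / (qPoch q q y.toNat * qPoch q q (x - y).toNat)
  else 0

/-- A Durfee system of length `L` for the `n × n` matrix `K`:  a family of triples of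
vectors `(Q k, a k, b k) ∈ ((ℤ≥0)^n)³`, `k = 0, …, L-1`, such that for every
`M ∈ (ℤ≥0)^n` one has, as rational functions in `q, z₁, …, z_n`,
`1/∏_i (z_i q; q)_{M_i} = Σ_k Σ_{m ∈ (ℤ≥0)^n} (∏_i z_i^{m_i + a_i}) q^{(m+a)·(N+b)}
  (1/∏_i (z_i q;q)_{N_i}) ∏_i [M_i + m_i - N_i - b_i choose m_i]_q`
with `N := K·m + Q k`.  (The inner sum, a priori over all of `(ℤ≥0)^n`, has finite
support since the q-binomial factors vanish unless `N_i + b_i ≤ M_i`.) -/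
def IsDurfeeSystem {n L : ℕ} (K : Matrix (Fin n) (Fin n) ℕ)
    (Q a b : Fin L → Fin n → ℕ) : Prop :=
  ∀ M : Fin n → ℕ,
    (∏ i, qPoch (qv n) (zv n i * qv n) (M i))⁻¹ =
      ∑ k : Fin L, ∑ᶠ m : Fin n → ℕ,
        (∏ i, zv n i ^ (m i + a k i)) *
        qv n ^ (∑ i, (m i + a k i) * (K.mulVec m i + Q k i + b k i)) *
        (∏ i, qPoch (qv n) (zv n i * qv n) (K.mulVec m i + Q k i))⁻¹ *
        ∏ i, qBinom (qv n) ((M i : ℤ) + m i - (K.mulVec m i + Q k i : ℕ) - b k i) (m i)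

/-- The limiting Universal Chiral Partition Function
`Z_∞(A; Q̃ | z; q) = Σ_{m ∈ (ℤ≥0)^n} (∏_i z_i^{m_i}) q^{½ m·A·m + Q̃·m} / ∏_i (q;q)_{m_i}`,
for real `q ∈ (0,1)` and positive real `z_i` (an absolutely convergent series, summed
here with `tsum`); the rational exponent is interpreted via the real power function. -/
def ZucpfInfty (n : ℕ) (A : Matrix (Fin n) (Fin n) ℚ) (Qt : Fin n → ℚ)
    (z : Fin n → ℝ) (q : ℝ) : ℝ :=
  ∑' m : Fin n → ℕ,
    (∏ i, z i ^ m i) *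
    q ^ ((((1 / 2) * ((fun i => (m i : ℚ)) ⬝ᵥ A.mulVec (fun i => (m i : ℚ))) +
      Qt ⬝ᵥ (fun i => (m i : ℚ))) : ℚ) : ℝ) /
    ∏ i, qPoch q q (m i)

section QSeries

variable {R S : Type*} [CommRing R] [CommRing S]

theorem qPoch_zero (q z : R) : qPoch q z 0 = 1 := by simp [qPoch]

theorem qPoch_succ (q z : R) (M : ℕ) :
    qPoch q z (M + 1) = qPoch q z M * (1 - z * q ^ M) :=
  Finset.prod_range_succ _ _

theorem qPoch_add (q z : R) (M N : ℕ) :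
    qPoch q z (M + N) = qPoch q z M * qPoch q (z * q ^ M) N := by
  simp only [qPoch, Finset.prod_range_add, pow_add, mul_assoc]

theorem map_qPoch (f : R →+* S) (q z : R) (M : ℕ) :
    f (qPoch q z M) = qPoch (f q) (f z) M := by
  simp [qPoch]

/-- The Gaussian binomial coefficient as a polynomial expression in `q`. -/
def gaussBinom (q : R) : ℕ → ℕ → R
  | _, 0 => 1
  | 0, _ + 1 => 0
  | n + 1, k + 1 => gaussBinom q n k + q ^ (k + 1) * gaussBinom q n (k + 1)

theorem gaussBinom_of_lt (q : R) : ∀ n k : ℕ, n < k → gaussBinom q n k = 0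
  | 0, 0, h => absurd h (lt_irrefl _)
  | 0, _ + 1, _ => by rw [gaussBinom]
  | n + 1, 0, h => absurd h (Nat.not_lt_zero _)
  | n + 1, k + 1, h => by
    rw [gaussBinom, gaussBinom_of_lt q n k (by omega), gaussBinom_of_lt q n (k + 1) (by omega)]
    simp

theorem gaussBinom_mul (q : R) : ∀ j m : ℕ,
    gaussBinom q (j + m) m * (qPoch q q m * qPoch q q j) = qPoch q q (j + m)
  | j, 0 => by simp [gaussBinom, qPoch_zero]
  | 0, k + 1 => by
    have h := gaussBinom_mul q 0 k
    simp only [zero_add, qPoch_zero, mul_one] at h ⊢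
    rw [gaussBinom, gaussBinom_of_lt q k (k + 1) (by omega), qPoch_succ]
    linear_combination (1 - q * q ^ k) * h
  | j + 1, k + 1 => by
    have h₁ := gaussBinom_mul q (j + 1) k
    have h₂ := gaussBinom_mul q j (k + 1)
    rw [show j + 1 + (k + 1) = (j + 1 + k) + 1 by ring, gaussBinom, qPoch_succ q q (j + 1 + k)]
    rw [show j + (k + 1) = j + 1 + k by ring] at h₂
    rw [qPoch_succ] at h₁ h₂
    rw [qPoch_succ, qPoch_succ]
    linear_combination (1 - q * q ^ k) * h₁ + q ^ (k + 1) * (1 - q * q ^ j) * h₂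

theorem map_gaussBinom (f : R →+* S) (q : R) : ∀ n k : ℕ,
    f (gaussBinom q n k) = gaussBinom (f q) n k
  | _, 0 => by simp [gaussBinom]
  | 0, _ + 1 => by simp [gaussBinom]
  | n + 1, k + 1 => by
    simp [gaussBinom, map_gaussBinom f q n k, map_gaussBinom f q n (k + 1)]

/-- The summand of a Durfee system after clearing the denominator `∏_i (z_i q; q)_{M_i}`. -/
def durfeeTerm {n : ℕ} (K : Matrix (Fin n) (Fin n) ℕ) (Q a b M m : Fin n → ℕ)
    (q : R) (z : Fin n → R) : R :=
  if ∀ i, K.mulVec m i + Q i + b i ≤ M i then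
    (∏ i, z i ^ (m i + a i)) * q ^ (∑ i, (m i + a i) * (K.mulVec m i + Q i + b i)) *
      (∏ i, qPoch q (z i * q * q ^ (K.mulVec m i + Q i)) (M i - (K.mulVec m i + Q i))) *
      ∏ i, gaussBinom q (M i - (K.mulVec m i + Q i + b i) + m i) (m i)
  else 0

theorem map_durfeeTerm (f : R →+* S) {n : ℕ} (K : Matrix (Fin n) (Fin n) ℕ)
    (Q a b M m : Fin n → ℕ) (q : R) (z : Fin n → R) :
    f (durfeeTerm K Q a b M m q z) = durfeeTerm K Q a b M m (f q) (fun i => f (z i)) := by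
  unfold durfeeTerm
  split_ifs <;> simp [map_qPoch, map_gaussBinom]

end QSeries

theorem qPoch_zv_ne_zero {n : ℕ} (i : Fin n) (M : ℕ) :
    qPoch (qv n) (zv n i * qv n) M ≠ 0 := by
  have h : (qPoch (MvPolynomial.X none) (MvPolynomial.X (some i) * MvPolynomial.X none) M :
      MvPolynomial (Option (Fin n)) ℚ) ≠ 0 := fun h => by
    have := congrArg (MvPolynomial.eval (fun _ => (0 : ℚ))) h
    rw [map_qPoch] at this
    simp [qPoch] at this
  rw [qv, zv, ← map_mul, ← map_qPoch]
  exact (map_ne_zero_iff _ (IsFractionRing.injective _ _)).2 h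

theorem qPoch_qv_ne_zero (n M : ℕ) : qPoch (qv n) (qv n) M ≠ 0 := by
  have h : (qPoch (MvPolynomial.X none) (MvPolynomial.X none) M :
      MvPolynomial (Option (Fin n)) ℚ) ≠ 0 := fun h => by
    have := congrArg (MvPolynomial.eval (fun _ => (0 : ℚ))) h
    rw [map_qPoch] at this
    simp [qPoch] at this
  rw [qv, ← map_qPoch]
  exact (map_ne_zero_iff _ (IsFractionRing.injective _ _)).2 h

theorem qBinom_qv (n M m N : ℕ) (b : ℕ) :
    qBinom (qv n) ((M : ℤ) + m - (N : ℕ) - b) m =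
      if N + b ≤ M then gaussBinom (qv n) (M - (N + b) + m) m else 0 := by
  unfold qBinom
  by_cases h : N + b ≤ M
  · rw [if_pos (by omega), if_pos h,
      show ((M : ℤ) + m - (N : ℕ) - b).toNat = M - (N + b) + m by omega,
      show ((M : ℤ) + m - (N : ℕ) - b - m).toNat = M - (N + b) by omega, Int.toNat_natCast,
      ← gaussBinom_mul, mul_div_cancel_right₀]
    exact mul_ne_zero (qPoch_qv_ne_zero _ _) (qPoch_qv_ne_zero _ _)
  · rw [if_neg (by omega), if_neg h]

section Durfee

variable {n L : ℕ} {K : Matrix (Fin n) (Fin n) ℕ}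

theorem le_mulVec_of_diag_pos (hK : ∀ i, 0 < K i i) (m : Fin n → ℕ) (i : Fin n) :
    m i ≤ K.mulVec m i :=
  (Nat.le_mul_of_pos_left _ (hK i)).trans
    (Finset.single_le_sum (f := fun j => K i j * m j) (fun _ _ => Nat.zero_le _)
      (Finset.mem_univ i))

theorem durfeeTerm_fraction (Q a b M m : Fin n → ℕ) :
    (∏ i, qPoch (qv n) (zv n i * qv n) (M i)) *
      ((∏ i, zv n i ^ (m i + a i)) *
        qv n ^ (∑ i, (m i + a i) * (K.mulVec m i + Q i + b i)) *
        (∏ i, qPoch (qv n) (zv n i * qv n) (K.mulVec m i + Q i))⁻¹ *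
        ∏ i, qBinom (qv n) ((M i : ℤ) + m i - (K.mulVec m i + Q i : ℕ) - b i) (m i)) =
      durfeeTerm K Q a b M m (qv n) (zv n) := by
  unfold durfeeTerm
  simp only [qBinom_qv]
  split_ifs with h
  · have h₁ : ∏ i, qPoch (qv n) (zv n i * qv n) (M i) =
        (∏ i, qPoch (qv n) (zv n i * qv n) (K.mulVec m i + Q i)) *
        ∏ i, qPoch (qv n) (zv n i * qv n * qv n ^ (K.mulVec m i + Q i))
          (M i - (K.mulVec m i + Q i)) := by
      rw [← Finset.prod_mul_distrib]
      refine Finset.prod_congr rfl fun i _ => ?_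
      rw [← qPoch_add, Nat.add_sub_cancel' (by have := h i; omega)]
    have h₂ : ∏ i, qPoch (qv n) (zv n i * qv n) (K.mulVec m i + Q i) ≠ 0 :=
      Finset.prod_ne_zero_iff.2 fun i _ => qPoch_zv_ne_zero _ _
    simp only [h, if_true]
    rw [h₁]
    linear_combination (∏ i, zv n i ^ (m i + a i)) *
      qv n ^ (∑ i, (m i + a i) * (K.mulVec m i + Q i + b i)) *
      (∏ i, qPoch (qv n) (zv n i * qv n * qv n ^ (K.mulVec m i + Q i))
        (M i - (K.mulVec m i + Q i))) *
      (∏ i, gaussBinom (qv n) (M i - (K.mulVec m i + Q i + b i) + m i) (m i)) *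
      mul_inv_cancel₀ h₂
  · push Not at h
    obtain ⟨i, hi⟩ := h
    exact mul_eq_zero_of_right _ (mul_eq_zero_of_right _
      (Finset.prod_eq_zero (Finset.mem_univ i) (if_neg hi.not_ge)))

/-- Clearing denominators, a Durfee system gives a polynomial identity, which may be evaluated
in any commutative `ℚ`-algebra. -/
theorem IsDurfeeSystem.sum_durfeeTerm {Q a b : Fin L → Fin n → ℕ} (hDur : IsDurfeeSystem K Q a b)
    (hK : ∀ i, 0 < K i i) {S : Type*} [CommRing S] [Algebra ℚ S] (q : S) (z : Fin n → S)
    (M : Fin n → ℕ) :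
    ∑ k, ∑ m ∈ Finset.Iic M, durfeeTerm K (Q k) (a k) (b k) M m q z = 1 := by
  have hF : ∑ k, ∑ m ∈ Finset.Iic M, durfeeTerm K (Q k) (a k) (b k) M m (qv n) (zv n) = 1 := by
    have h₀ : ∏ i, qPoch (qv n) (zv n i * qv n) (M i) ≠ 0 :=
      Finset.prod_ne_zero_iff.2 fun i _ => qPoch_zv_ne_zero _ _
    rw [← mul_inv_cancel₀ h₀, hDur M, Finset.mul_sum]
    refine Finset.sum_congr rfl fun k _ => ?_
    rw [finsum_eq_sum_of_support_subset (s := Finset.Iic M), Finset.mul_sum]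
    · exact Finset.sum_congr rfl fun m _ => (durfeeTerm_fraction _ _ _ _ _).symm
    · intro m hm
      rw [Finset.coe_Iic, Set.mem_Iic]
      by_contra hle
      rw [Pi.le_def] at hle
      push Not at hle
      obtain ⟨i, hi⟩ := hle
      refine hm ?_
      have := le_mulVec_of_diag_pos hK m i
      refine mul_eq_zero_of_right _ (Finset.prod_eq_zero (Finset.mem_univ i) ?_)
      rw [qBinom_qv, if_neg (by omega)]
  have hP : ∑ k, ∑ m ∈ Finset.Iic M, durfeeTerm K (Q k) (a k) (b k) M m
      (MvPolynomial.X none : MvPolynomial (Option (Fin n)) ℚ)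
      (fun i => MvPolynomial.X (some i)) = 1 := by
    apply IsFractionRing.injective (MvPolynomial (Option (Fin n)) ℚ) (FF n)
    simp only [map_sum, map_durfeeTerm, map_one]
    exact hF
  have := congrArg (MvPolynomial.aeval (R := ℚ) (fun o : Option (Fin n) => o.elim q z)).toRingHom hP
  simp only [map_sum, map_durfeeTerm, map_one] at this
  simpa using this

end Durfee

section Specialization

variable {n : ℕ} {q : ℝ}

theorem qPoch_pos (hq0 : 0 < q) (hq1 : q < 1) (j M : ℕ) : 0 < qPoch q (q * q ^ j) M := by
  refine Finset.prod_pos fun k _ => ?_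
  rw [mul_assoc, ← pow_add, ← pow_succ', sub_pos]
  exact pow_lt_one₀ hq0.le hq1 (Nat.succ_ne_zero _)

theorem qPoch_self_pos (hq0 : 0 < q) (hq1 : q < 1) (M : ℕ) : 0 < qPoch q q M := by
  simpa using qPoch_pos hq0 hq1 0 M

theorem qPoch_zpow (hq0 : 0 < q) (hq1 : q < 1) (p : ℤ) {N M : ℕ} (hNM : N ≤ M)
    (hM : 0 ≤ M + p) :
    qPoch q (q ^ p * q * q ^ N) (M - N) =
      if 0 ≤ N + p then qPoch q q (M + p).toNat / qPoch q q (N + p).toNat else 0 := by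
  split_ifs with h
  · obtain ⟨r, hr⟩ := Int.eq_ofNat_of_zero_le h
    rw [show (M + p).toNat = r + (M - N) by omega, show (N + p).toNat = r by omega, qPoch_add,
      mul_div_cancel_left₀ _ (qPoch_self_pos hq0 hq1 r).ne']
    congr 1
    rw [mul_right_comm, ← zpow_natCast, ← zpow_add₀ hq0.ne', add_comm p, hr,
      zpow_natCast, mul_comm]
  · refine Finset.prod_eq_zero (i := (-(p + N + 1)).toNat) (Finset.mem_range.2 (by omega)) ?_
    rw [← zpow_natCast, ← zpow_natCast, ← zpow_add_one₀ hq0.ne', ← zpow_add₀ hq0.ne',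
      ← zpow_add₀ hq0.ne', show p + 1 + N + ((-(p + N + 1)).toNat : ℤ) = 0 by omega, zpow_zero,
      sub_self]

theorem gaussBinom_eq_div (hq0 : 0 < q) (hq1 : q < 1) (j m : ℕ) :
    gaussBinom q (j + m) m = qPoch q (q * q ^ j) m / qPoch q q m := by
  have h := gaussBinom_mul q j m
  rw [qPoch_add, mul_comm (qPoch q q m), ← mul_assoc, mul_right_comm, mul_comm] at h
  rw [eq_div_iff (qPoch_self_pos hq0 hq1 m).ne']
  exact mul_left_cancel₀ (qPoch_self_pos hq0 hq1 j).ne' h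

/-- The limit as `M → ∞` of the summand of a Durfee system specialised at `z_i = q ^ p_i`, divided
by `∏_i (q; q)_{p_i}` suitably interpreted when some `p_i` is negative. -/
def limitTerm (K : Matrix (Fin n) (Fin n) ℕ) (Q a b : Fin n → ℕ) (q : ℝ) (p : Fin n → ℤ)
    (m : Fin n → ℕ) : ℝ :=
  if ∀ i, 0 ≤ ((K.mulVec m i + Q i : ℕ) : ℤ) + p i then
    q ^ (∑ i, (m i + a i) * ((((K.mulVec m i + Q i : ℕ) : ℤ) + p i).toNat + b i)) /
      ((∏ i, qPoch q q (m i)) * ∏ i, qPoch q q (((K.mulVec m i + Q i : ℕ) : ℤ) + p i).toNat)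
  else 0

/-- The finite-`M` version of `limitTerm`. -/
def truncTerm (K : Matrix (Fin n) (Fin n) ℕ) (Q a b : Fin n → ℕ) (q : ℝ) (p : Fin n → ℤ)
    (M : ℕ) (m : Fin n → ℕ) : ℝ :=
  if ∀ i, K.mulVec m i + Q i + b i ≤ M then
    limitTerm K Q a b q p m * ∏ i, qPoch q (q * q ^ (M - (K.mulVec m i + Q i + b i))) (m i)
  else 0

variable (K : Matrix (Fin n) (Fin n) ℕ) (Q a b : Fin n → ℕ) (p : Fin n → ℤ)

theorem limitTerm_nonneg (hq0 : 0 < q) (hq1 : q < 1) (m : Fin n → ℕ) :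
    0 ≤ limitTerm K Q a b q p m := by
  unfold limitTerm
  split_ifs
  · exact div_nonneg (pow_nonneg hq0.le _) (mul_nonneg
      (Finset.prod_nonneg fun i _ => (qPoch_self_pos hq0 hq1 _).le)
      (Finset.prod_nonneg fun i _ => (qPoch_self_pos hq0 hq1 _).le))
  · exact le_rfl

theorem truncTerm_nonneg (hq0 : 0 < q) (hq1 : q < 1) (M : ℕ) (m : Fin n → ℕ) :
    0 ≤ truncTerm K Q a b q p M m := by
  unfold truncTerm
  split_ifs
  · exact mul_nonneg (limitTerm_nonneg K Q a b p hq0 hq1 m)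
      (Finset.prod_nonneg fun i _ => (qPoch_pos hq0 hq1 _ _).le)
  · exact le_rfl

theorem truncTerm_monotone (hq0 : 0 < q) (hq1 : q < 1) (m : Fin n → ℕ) :
    Monotone fun M => truncTerm K Q a b q p M m := by
  intro M M' hMM
  dsimp only
  by_cases h : ∀ i, K.mulVec m i + Q i + b i ≤ M
  · rw [truncTerm, truncTerm, if_pos h, if_pos fun i => (h i).trans hMM]
    refine mul_le_mul_of_nonneg_left ?_ (limitTerm_nonneg K Q a b p hq0 hq1 m)
    refine Finset.prod_le_prod (fun i _ => (qPoch_pos hq0 hq1 _ _).le) fun i _ => ?_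
    refine Finset.prod_le_prod (fun k _ => ?_) fun k _ => ?_
    · rw [mul_assoc, ← pow_add, ← pow_succ', sub_nonneg]
      exact pow_le_one₀ hq0.le hq1.le
    · have := pow_le_pow_of_le_one hq0.le hq1.le
        (show M - (K.mulVec m i + Q i + b i) ≤ M' - (K.mulVec m i + Q i + b i) by omega)
      gcongr
  · rw [truncTerm, if_neg h]
    exact truncTerm_nonneg K Q a b p hq0 hq1 M' m

theorem tendsto_truncTerm (hq0 : 0 < q) (hq1 : q < 1) (m : Fin n → ℕ) :
    Filter.Tendsto (fun M => truncTerm K Q a b q p M m) Filter.atTop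
      (nhds (limitTerm K Q a b q p m)) := by
  have h : Filter.Tendsto (fun M : ℕ => limitTerm K Q a b q p m *
      ∏ i, qPoch q (q * q ^ (M - (K.mulVec m i + Q i + b i))) (m i)) Filter.atTop
      (nhds (limitTerm K Q a b q p m * ∏ i : Fin n, ∏ k ∈ Finset.range (m i),
        (1 - q * 0 * q ^ k))) := by
    refine Filter.Tendsto.const_mul _ (tendsto_finsetProd _ fun i _ =>
      tendsto_finsetProd _ fun k _ => ?_)
    refine Filter.Tendsto.const_sub _ (Filter.Tendsto.mul_const _ (Filter.Tendsto.const_mul _ ?_))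
    exact (tendsto_pow_atTop_nhds_zero_of_lt_one hq0.le hq1).comp (Filter.tendsto_sub_atTop_nat _)
  simp only [mul_zero, zero_mul, sub_zero, Finset.prod_const_one, mul_one] at h
  refine h.congr' ?_
  filter_upwards [Filter.eventually_all.2 fun i =>
    Filter.eventually_ge_atTop (K.mulVec m i + Q i + b i)] with M hM
  rw [truncTerm, if_pos hM]

theorem durfeeTerm_zpow (hq0 : 0 < q) (hq1 : q < 1) {M : ℕ} (hM : ∀ i, 0 ≤ M + p i)
    (m : Fin n → ℕ) :
    durfeeTerm K Q a b (fun _ => M) m q (fun i => q ^ p i) =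
      (∏ i, qPoch q q (M + p i).toNat) * truncTerm K Q a b q p M m := by
  unfold durfeeTerm truncTerm
  split_ifs with h
  · have hpoch : ∏ i, qPoch q (q ^ p i * q * q ^ (K.mulVec m i + Q i))
        (M - (K.mulVec m i + Q i)) = ∏ i, if 0 ≤ ((K.mulVec m i + Q i : ℕ) : ℤ) + p i then
          qPoch q q (M + p i).toNat / qPoch q q (((K.mulVec m i + Q i : ℕ) : ℤ) + p i).toNat
          else 0 :=
      Finset.prod_congr rfl fun i _ =>
        qPoch_zpow hq0 hq1 (p i) ((Nat.le_add_right _ _).trans (h i)) (hM i)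
    rw [hpoch]
    unfold limitTerm
    split_ifs with h'
    · simp only [h', if_true, gaussBinom_eq_div hq0 hq1, Finset.prod_div_distrib]
      have hpow : (∏ i, (q ^ p i) ^ (m i + a i)) *
          q ^ (∑ i, (m i + a i) * (K.mulVec m i + Q i + b i)) =
          q ^ (∑ i, (m i + a i) * ((((K.mulVec m i + Q i : ℕ) : ℤ) + p i).toNat + b i)) := by
        rw [← Finset.prod_pow_eq_pow_sum, ← Finset.prod_pow_eq_pow_sum, ← Finset.prod_mul_distrib]
        refine Finset.prod_congr rfl fun i _ => ?_
        rw [mul_comm (m i + a i), mul_comm (m i + a i), pow_mul, pow_mul, ← mul_pow]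
        congr 1
        rw [← zpow_natCast, ← zpow_natCast, ← zpow_add₀ hq0.ne']
        congr 1
        have := h' i
        omega
      rw [hpow]
      field_simp
    · push Not at h'
      obtain ⟨i, hi⟩ := h'
      exact mul_eq_zero_of_left (mul_eq_zero_of_right _
        (Finset.prod_eq_zero (Finset.mem_univ i) (if_neg hi.not_ge))) _ |>.trans (by simp)
  · simp

end Specialization

section Limit

variable {n L : ℕ} {q : ℝ}

theorem summable_norm_neg_pow_succ (hq0 : 0 < q) (hq1 : q < 1) :
    Summable fun j : ℕ => ‖-q ^ (j + 1)‖ := by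
  simp only [norm_neg, norm_pow, Real.norm_eq_abs, abs_of_pos hq0]
  exact (summable_nat_add_iff 1).2 (summable_geometric_of_lt_one hq0.le hq1)

theorem tendsto_qPoch_self (hq0 : 0 < q) (hq1 : q < 1) :
    Filter.Tendsto (qPoch q q) Filter.atTop (nhds (∏' j : ℕ, (1 - q ^ (j + 1)))) := by
  have h := (multipliable_one_add_of_summable
    (summable_norm_neg_pow_succ hq0 hq1)).hasProd.tendsto_prod_nat
  simp only [← sub_eq_add_neg] at h
  exact h.congr fun M => by simp only [qPoch, pow_succ']

theorem tprod_one_sub_pow_ne_zero (hq0 : 0 < q) (hq1 : q < 1) :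
    ∏' j : ℕ, (1 - q ^ (j + 1)) ≠ 0 := by
  have h := tprod_one_add_ne_zero_of_summable (f := fun j : ℕ => -q ^ (j + 1))
    (fun j => by
      rw [← sub_eq_add_neg]
      exact (sub_pos.2 (pow_lt_one₀ hq0.le hq1 (Nat.succ_ne_zero _))).ne')
    (summable_norm_neg_pow_succ hq0 hq1)
  simpa only [← sub_eq_add_neg] using h

theorem IsDurfeeSystem.sum_truncTerm {K : Matrix (Fin n) (Fin n) ℕ} {Q a b : Fin L → Fin n → ℕ}
    (hDur : IsDurfeeSystem K Q a b) (hK : ∀ i, 0 < K i i) (hq0 : 0 < q) (hq1 : q < 1)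
    (p : Fin n → ℤ) {M : ℕ} (hM : ∀ i, 0 ≤ M + p i) :
    ∑ k, ∑' m, ENNReal.ofReal (truncTerm K (Q k) (a k) (b k) q p M m) =
      ENNReal.ofReal (∏ i, qPoch q q (M + p i).toNat)⁻¹ := by
  have h := hDur.sum_durfeeTerm hK q (fun i => q ^ p i) (fun _ => M)
  simp only [durfeeTerm_zpow _ _ _ _ p hq0 hq1 hM, ← Finset.mul_sum] at h
  rw [← eq_inv_of_mul_eq_one_right h, ENNReal.ofReal_sum_of_nonneg fun k _ =>
    Finset.sum_nonneg fun m _ => truncTerm_nonneg _ _ _ _ p hq0 hq1 M m]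
  refine Finset.sum_congr rfl fun k _ => ?_
  rw [ENNReal.ofReal_sum_of_nonneg fun m _ => truncTerm_nonneg _ _ _ _ p hq0 hq1 M m]
  refine tsum_eq_sum fun m hm => ?_
  rw [Finset.mem_Iic, Pi.le_def] at hm
  push Not at hm
  obtain ⟨i, hi⟩ := hm
  have := le_mulVec_of_diag_pos hK m i
  rw [truncTerm, if_neg, ENNReal.ofReal_zero]
  exact fun h => by have := h i; omega

theorem IsDurfeeSystem.sum_limitTerm {K : Matrix (Fin n) (Fin n) ℕ} {Q a b : Fin L → Fin n → ℕ}
    (hDur : IsDurfeeSystem K Q a b) (hK : ∀ i, 0 < K i i) (hq0 : 0 < q) (hq1 : q < 1)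
    (p : Fin n → ℤ) :
    ∑ k, ∑' m, ENNReal.ofReal (limitTerm K (Q k) (a k) (b k) q p m) =
      ENNReal.ofReal ((∏' j : ℕ, (1 - q ^ (j + 1))) ^ (-(n : ℤ))) := by
  have hl : Filter.Tendsto (fun M => ∑ k, ∑' m,
      ENNReal.ofReal (truncTerm K (Q k) (a k) (b k) q p M m)) Filter.atTop
      (nhds (∑ k, ∑' m, ENNReal.ofReal (limitTerm K (Q k) (a k) (b k) q p m))) := by
    refine tendsto_finsetSum _ fun k _ => ?_
    simp only [← MeasureTheory.lintegral_count]
    refine MeasureTheory.lintegral_tendsto_of_tendsto_of_monotone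
      (fun M => (measurable_of_countable _).aemeasurable)
      (Filter.Eventually.of_forall fun m => ?_) (Filter.Eventually.of_forall fun m => ?_)
    · exact fun M M' h => ENNReal.ofReal_le_ofReal (truncTerm_monotone _ _ _ _ p hq0 hq1 m h)
    · exact ENNReal.tendsto_ofReal (tendsto_truncTerm _ _ _ _ p hq0 hq1 m)
  have hr : Filter.Tendsto (fun M : ℕ => ENNReal.ofReal (∏ i, qPoch q q (M + p i).toNat)⁻¹)
      Filter.atTop (nhds (ENNReal.ofReal ((∏' j : ℕ, (1 - q ^ (j + 1))) ^ (-(n : ℤ))))) := by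
    refine ENNReal.tendsto_ofReal ?_
    rw [_root_.zpow_neg, zpow_natCast]
    refine Filter.Tendsto.inv₀ ?_ (pow_ne_zero _ (tprod_one_sub_pow_ne_zero hq0 hq1))
    have hi : ∀ i, Filter.Tendsto (fun M : ℕ => qPoch q q (M + p i).toNat) Filter.atTop
        (nhds (∏' j : ℕ, (1 - q ^ (j + 1)))) := fun i =>
      (tendsto_qPoch_self hq0 hq1).comp (Filter.tendsto_atTop.2 fun c => by
        filter_upwards [Filter.eventually_ge_atTop (c + (-p i).toNat)] with M hM
        omega)
    simpa using tendsto_finsetProd Finset.univ fun i _ => hi i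
  refine tendsto_nhds_unique (hl.congr' ?_) hr
  filter_upwards [Filter.eventually_all.2 fun i => Filter.eventually_ge_atTop (-p i).toNat] with M hM
  exact hDur.sum_truncTerm hK hq0 hq1 p fun i => by have := hM i; omega

end Limit

section QuadraticForm

variable {n : ℕ}

theorem Matrix.PosDef.sq_le_diag_mul_inv {A : Matrix (Fin n) (Fin n) ℚ} (hA : A.PosDef)
    (p : Fin n → ℚ) (i : Fin n) : p i ^ 2 ≤ A i i * (p ⬝ᵥ A⁻¹.mulVec p) := by
  have hdet : IsUnit A.det := (Matrix.isUnit_iff_isUnit_det A).1 hA.isUnit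
  obtain ⟨x, hx⟩ : ∃ x, x = A⁻¹.mulVec p := ⟨_, rfl⟩
  have hAx : A.mulVec x = p := by
    rw [hx, Matrix.mulVec_mulVec, Matrix.mul_nonsing_inv _ hdet, Matrix.one_mulVec]
  have hsymm : Aᵀ = A := by simpa using hA.isHermitian.eq
  have hd : 0 < A i i := hA.diag_pos
  have hcross : x ⬝ᵥ A.mulVec (Pi.single i (p i)) = p i ^ 2 := by
    rw [Matrix.dotProduct_mulVec, ← Matrix.mulVec_transpose, hsymm, hAx, dotProduct_single, sq]
  have h := hA.posSemidef.dotProduct_mulVec_nonneg (A i i • x - Pi.single i (p i))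
  simp only [star_trivial, Matrix.mulVec_sub, Matrix.mulVec_smul, hAx, sub_dotProduct,
    dotProduct_sub, smul_dotProduct, dotProduct_smul, single_dotProduct, hcross,
    smul_eq_mul] at h
  rw [Matrix.mulVec_single, ← hx] at *
  simp only [Pi.smul_apply, Matrix.col_apply, MulOpposite.smul_eq_mul_unop,
    MulOpposite.unop_op] at h
  rw [dotProduct_comm p x]
  nlinarith

theorem Matrix.PosDef.sum_sq_le_trace_mul_inv {A : Matrix (Fin n) (Fin n) ℚ} (hA : A.PosDef)
    (p : Fin n → ℚ) : ∑ i, p i ^ 2 ≤ (A.trace + 1) * (p ⬝ᵥ A⁻¹.mulVec p) := by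
  have h₀ : 0 ≤ p ⬝ᵥ A⁻¹.mulVec p := by
    simpa using hA.inv.posSemidef.dotProduct_mulVec_nonneg p
  calc ∑ i, p i ^ 2 ≤ ∑ i, A i i * (p ⬝ᵥ A⁻¹.mulVec p) :=
        Finset.sum_le_sum fun i _ => hA.sq_le_diag_mul_inv p i
    _ = A.trace * (p ⬝ᵥ A⁻¹.mulVec p) := by rw [← Finset.sum_mul]; rfl
    _ ≤ _ := by linarith

theorem ENNReal.tsum_pi_prod : ∀ {n : ℕ} (f : Fin n → ℤ → ENNReal),
    ∑' p : Fin n → ℤ, ∏ i, f i (p i) = ∏ i, ∑' x, f i x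
  | 0, f => by simp
  | n + 1, f => by
    rw [← (Fin.consEquiv (fun _ : Fin (n + 1) => ℤ)).tsum_eq, ENNReal.tsum_prod', Fin.prod_univ_succ,
      ← ENNReal.tsum_pi_prod fun i => f i.succ, ← ENNReal.tsum_mul_right]
    refine tsum_congr fun x => ?_
    rw [← ENNReal.tsum_mul_left]
    refine tsum_congr fun y => ?_
    simp [Fin.consEquiv, Fin.prod_univ_succ]

theorem summable_zpow_mul_rpow_sq {q c z : ℝ} (hq0 : 0 < q) (hq1 : q < 1) (hc : 0 < c)
    (hz : 0 < z) : Summable fun x : ℤ => z ^ x * q ^ (c * (x : ℝ) ^ 2) := by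
  have hT : 0 < -(c * Real.log q) / Real.pi :=
    div_pos (by have := Real.log_neg hq0 hq1; nlinarith) Real.pi_pos
  refine (summable_pow_mul_jacobiTheta₂_term_bound
    (|Real.log z| / (2 * Real.pi)) hT 0).of_nonneg_of_le (fun x => by positivity) fun x => ?_
  rw [pow_zero, one_mul, ← Real.rpow_intCast, Real.rpow_def_of_pos hz, Real.rpow_def_of_pos hq0,
    ← Real.exp_add, Real.exp_le_exp]
  have h₁ : Real.log z * x ≤ |Real.log z| * |(x : ℝ)| := (le_abs_self _).trans (abs_mul _ _).le
  have h₂ : -Real.pi * (-(c * Real.log q) / Real.pi * (x : ℝ) ^ 2 -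
      2 * (|Real.log z| / (2 * Real.pi)) * ((|x| : ℤ) : ℝ)) =
      c * Real.log q * (x : ℝ) ^ 2 + |Real.log z| * |(x : ℝ)| := by
    have := Real.pi_ne_zero
    push_cast
    field_simp
    ring
  rw [h₂]
  linarith

/-- The summand of the lattice theta series attached to the quadratic form `A⁻¹`. -/
def thetaTerm (A : Matrix (Fin n) (Fin n) ℚ) (z : Fin n → ℝ) (q : ℝ) (p : Fin n → ℤ) : ℝ :=
  (∏ i, z i ^ p i) *
    q ^ ((((1 / 2) * ((fun i => (p i : ℚ)) ⬝ᵥ A⁻¹.mulVec (fun i => (p i : ℚ)))) : ℚ) : ℝ)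

theorem thetaTerm_nonneg {A : Matrix (Fin n) (Fin n) ℚ} {z : Fin n → ℝ} {q : ℝ} (hq0 : 0 < q)
    (hz : ∀ i, 0 < z i) (p : Fin n → ℤ) : 0 ≤ thetaTerm A z q p :=
  mul_nonneg (Finset.prod_nonneg fun i _ => (zpow_pos (hz i) _).le) (Real.rpow_nonneg hq0.le _)

theorem tsum_thetaTerm_ne_top {A : Matrix (Fin n) (Fin n) ℚ} (hA : A.PosDef) {z : Fin n → ℝ}
    {q : ℝ} (hq0 : 0 < q) (hq1 : q < 1) (hz : ∀ i, 0 < z i) :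
    ∑' p, ENNReal.ofReal (thetaTerm A z q p) ≠ ⊤ := by
  have ht : 0 < A.trace + 1 := by
    have : 0 ≤ A.trace := Finset.sum_nonneg fun i _ => hA.diag_pos.le
    linarith
  obtain ⟨c, hc⟩ : ∃ c : ℚ, c = 1 / (2 * (A.trace + 1)) := ⟨_, rfl⟩
  have hc0 : 0 < (c : ℝ) := by rw [hc]; exact_mod_cast by positivity
  have hle : ∀ p, ENNReal.ofReal (thetaTerm A z q p) ≤
      ∏ i, ENNReal.ofReal (z i ^ p i * q ^ ((c : ℝ) * (p i : ℝ) ^ 2)) := fun p => by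
    have hz' : ∀ i, 0 ≤ z i ^ p i := fun i => (zpow_pos (hz i) _).le
    rw [← ENNReal.ofReal_prod_of_nonneg fun i _ => mul_nonneg (hz' i) (Real.rpow_nonneg hq0.le _),
      Finset.prod_mul_distrib, ← Real.rpow_sum_of_pos hq0]
    refine ENNReal.ofReal_le_ofReal (mul_le_mul_of_nonneg_left
      (Real.rpow_le_rpow_of_exponent_ge hq0 hq1.le ?_) (Finset.prod_nonneg fun i _ => hz' i))
    have h := hA.sum_sq_le_trace_mul_inv fun i => (p i : ℚ)
    have h' : ∑ i, c * (p i : ℚ) ^ 2 ≤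
        (1 / 2) * ((fun i => (p i : ℚ)) ⬝ᵥ A⁻¹.mulVec (fun i => (p i : ℚ))) := by
      rw [← Finset.mul_sum, hc, div_mul_eq_mul_div, one_mul, div_le_iff₀ (by positivity)]
      linarith
    exact_mod_cast h'
  refine ne_top_of_le_ne_top ?_ (ENNReal.tsum_le_tsum hle)
  rw [ENNReal.tsum_pi_prod fun i x => ENNReal.ofReal (z i ^ x * q ^ ((c : ℝ) * (x : ℝ) ^ 2))]
  exact ENNReal.prod_ne_top fun i _ =>
    (summable_zpow_mul_rpow_sq hq0 hq1 hc0 (hz i)).tsum_ofReal_ne_top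

theorem ucpf_exponent_identity {A : Matrix (Fin n) (Fin n) ℚ} (hA : IsUnit A.det)
    (hsymm : Aᵀ = A) (Q a b m m' : Fin n → ℚ) :
    (1 / 2) * (Q ⬝ᵥ A⁻¹.mulVec Q) + a ⬝ᵥ b + ((1 / 2) * (m ⬝ᵥ A.mulVec m) + (Q + b) ⬝ᵥ m) +
      ((1 / 2) * (m' ⬝ᵥ A⁻¹.mulVec m') + (-A⁻¹.mulVec Q + a) ⬝ᵥ m') =
    (1 / 2) * ((m' - (A.mulVec m + Q)) ⬝ᵥ A⁻¹.mulVec (m' - (A.mulVec m + Q))) +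
      (m + a) ⬝ᵥ (m' + b) := by
  have hA' : A⁻¹ᵀ = A⁻¹ := by rw [Matrix.transpose_nonsing_inv, hsymm]
  have h₁ : A⁻¹.mulVec (A.mulVec m) = m := by
    rw [Matrix.mulVec_mulVec, Matrix.nonsing_inv_mul _ hA, Matrix.one_mulVec]
  have h₂ : ∀ x, A.mulVec m ⬝ᵥ A⁻¹.mulVec x = m ⬝ᵥ x := fun x => by
    rw [Matrix.dotProduct_mulVec, ← Matrix.mulVec_transpose, hA', h₁]
  have h₃ : Q ⬝ᵥ A⁻¹.mulVec m' = m' ⬝ᵥ A⁻¹.mulVec Q := by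
    rw [Matrix.dotProduct_mulVec, ← Matrix.mulVec_transpose, hA', dotProduct_comm]
  simp only [Matrix.mulVec_sub, Matrix.mulVec_add, h₁, sub_dotProduct, dotProduct_sub,
    add_dotProduct, dotProduct_add, neg_dotProduct, h₂, h₃]
  rw [dotProduct_comm (A.mulVec m) m, dotProduct_comm (A⁻¹.mulVec Q) m', dotProduct_comm m' m,
    dotProduct_comm b m, dotProduct_comm Q m]
  ring

end QuadraticForm

section Character

variable {n L : ℕ}

/-- The summand of `ZucpfInfty`. -/
def ucpfTerm (A : Matrix (Fin n) (Fin n) ℚ) (Qt : Fin n → ℚ) (z : Fin n → ℝ) (q : ℝ)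
    (m : Fin n → ℕ) : ℝ :=
  (∏ i, z i ^ m i) *
    q ^ ((((1 / 2) * ((fun i => (m i : ℚ)) ⬝ᵥ A.mulVec (fun i => (m i : ℚ))) +
      Qt ⬝ᵥ (fun i => (m i : ℚ))) : ℚ) : ℝ) /
    ∏ i, qPoch q q (m i)

theorem ucpfTerm_nonneg (A : Matrix (Fin n) (Fin n) ℚ) (Qt : Fin n → ℚ) {z : Fin n → ℝ} {q : ℝ}
    (hq0 : 0 < q) (hq1 : q < 1) (hz : ∀ i, 0 < z i) (m : Fin n → ℕ) :
    0 ≤ ucpfTerm A Qt z q m :=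
  div_nonneg (mul_nonneg (Finset.prod_nonneg fun i _ => pow_nonneg (hz i).le _)
    (Real.rpow_nonneg hq0.le _)) (Finset.prod_nonneg fun _ _ => (qPoch_self_pos hq0 hq1 _).le)

theorem ZucpfInfty_eq_toReal (A : Matrix (Fin n) (Fin n) ℚ) (Qt : Fin n → ℚ) {z : Fin n → ℝ}
    {q : ℝ} (hq0 : 0 < q) (hq1 : q < 1) (hz : ∀ i, 0 < z i) :
    ZucpfInfty n A Qt z q = (∑' m, ENNReal.ofReal (ucpfTerm A Qt z q m)).toReal := by
  rw [ENNReal.tsum_toReal_eq fun _ => ENNReal.ofReal_ne_top]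
  exact tsum_congr fun m => (ENNReal.toReal_ofReal (ucpfTerm_nonneg A Qt hq0 hq1 hz m)).symm

/-- The prefactor of the `k`-th summand in the character identity. -/
def ucpfCoeff (A : Matrix (Fin n) (Fin n) ℚ) (Q a b : Fin n → ℕ) (z : Fin n → ℝ) (q : ℝ) : ℝ :=
  (∏ i, z i ^ (-(Q i : ℤ))) *
    q ^ (((1 / 2) * ((fun i => (Q i : ℚ)) ⬝ᵥ A⁻¹.mulVec (fun i => (Q i : ℚ))) +
      ∑ i, (a i : ℚ) * (b i : ℚ) : ℚ) : ℝ)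

theorem ucpfCoeff_nonneg (A : Matrix (Fin n) (Fin n) ℚ) (Q a b : Fin n → ℕ) {z : Fin n → ℝ}
    {q : ℝ} (hq0 : 0 < q) (hz : ∀ i, 0 < z i) : 0 ≤ ucpfCoeff A Q a b z q :=
  mul_nonneg (Finset.prod_nonneg fun i _ => (zpow_pos (hz i) _).le) (Real.rpow_nonneg hq0.le _)

variable {K : Matrix (Fin n) (Fin n) ℕ} {z : Fin n → ℝ} {q : ℝ}

theorem prod_zpow_shift (hsym : K.IsSymm) (hz : ∀ i, 0 < z i) (Q m m' : Fin n → ℕ) :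
    (∏ i, z i ^ (-(Q i : ℤ))) * (∏ i, (∏ j, z j ^ (-(K i j : ℤ))) ^ m i) * ∏ i, z i ^ m' i =
      ∏ i, z i ^ ((m' i : ℤ) - (K.mulVec m i + Q i : ℕ)) := by
  have h : ∏ i, (∏ j, z j ^ (-(K i j : ℤ))) ^ m i = ∏ i, z i ^ (-(K.mulVec m i : ℤ)) := by
    simp only [← Finset.prod_pow]
    rw [Finset.prod_comm]
    refine Finset.prod_congr rfl fun j _ => ?_
    simp only [_root_.zpow_neg, zpow_natCast, inv_pow, ← pow_mul, Finset.prod_inv_distrib,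
      Finset.prod_pow_eq_pow_sum]
    congr 2
    exact Finset.sum_congr rfl fun i _ => by rw [hsym.apply]
  rw [h, ← Finset.prod_mul_distrib, ← Finset.prod_mul_distrib]
  refine Finset.prod_congr rfl fun i _ => ?_
  rw [← zpow_natCast, ← zpow_add₀ (hz i).ne', ← zpow_add₀ (hz i).ne']
  congr 1
  push_cast
  ring

theorem ucpf_summand_eq (hsym : K.IsSymm) (hpd : (K.map (Nat.cast : ℕ → ℚ)).PosDef)
    (Q a b : Fin n → ℕ) (hq0 : 0 < q) (hz : ∀ i, 0 < z i) (m m' : Fin n → ℕ) :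
    ucpfCoeff (K.map (Nat.cast : ℕ → ℚ)) Q a b z q *
      ucpfTerm (K.map (Nat.cast : ℕ → ℚ)) (fun i => (Q i : ℚ) + (b i : ℚ))
        (fun i => ∏ j, z j ^ (-(K i j : ℤ))) q m *
      ucpfTerm (K.map (Nat.cast : ℕ → ℚ))⁻¹
        (fun i => -(K.map (Nat.cast : ℕ → ℚ))⁻¹.mulVec (fun j => (Q j : ℚ)) i + (a i : ℚ)) z q m' =
    thetaTerm (K.map (Nat.cast : ℕ → ℚ)) z q (fun i => (m' i : ℤ) - (K.mulVec m i + Q i : ℕ)) *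
      limitTerm K Q a b q (fun i => (m' i : ℤ) - (K.mulVec m i + Q i : ℕ)) m := by
  have hN : ∀ i, ((K.mulVec m i + Q i : ℕ) : ℤ) + ((m' i : ℤ) - (K.mulVec m i + Q i : ℕ)) = m' i :=
    fun i => by ring
  have hdet : IsUnit (K.map (Nat.cast : ℕ → ℚ)).det :=
    (Matrix.isUnit_iff_isUnit_det _).1 hpd.isUnit
  have hsymm : (K.map (Nat.cast : ℕ → ℚ))ᵀ = K.map (Nat.cast : ℕ → ℚ) := by
    rw [← Matrix.transpose_map, hsym.eq]
  have hexp := ucpf_exponent_identity hdet hsymm (fun i => (Q i : ℚ)) (fun i => (a i : ℚ))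
    (fun i => (b i : ℚ)) (fun i => (m i : ℚ)) (fun i => (m' i : ℚ))
  have hKm : (K.map (Nat.cast : ℕ → ℚ)).mulVec (fun i => (m i : ℚ)) =
      fun i => (K.mulVec m i : ℚ) := by
    ext i
    simp [Matrix.mulVec, dotProduct]
  have hp : (fun i => (((m' i : ℤ) - (K.mulVec m i + Q i : ℕ) : ℤ) : ℚ)) =
      (fun i => (m' i : ℚ)) - ((K.map (Nat.cast : ℕ → ℚ)).mulVec (fun i => (m i : ℚ)) +
        fun i => (Q i : ℚ)) := by
    rw [hKm]
    ext i
    simp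
  have hnat : ((∑ i, (m i + a i) * (m' i + b i) : ℕ) : ℚ) =
      ((fun i => (m i : ℚ)) + fun i => (a i : ℚ)) ⬝ᵥ
        ((fun i => (m' i : ℚ)) + fun i => (b i : ℚ)) := by
    simp [dotProduct]
  unfold limitTerm thetaTerm ucpfCoeff ucpfTerm
  simp only [hN, Int.toNat_natCast, Int.natCast_nonneg, implies_true, if_true]
  rw [← prod_zpow_shift hsym hz]
  have hq : ∀ {u v w x : ℚ} {s : ℕ}, u + v + w = x + s →
      q ^ (u : ℝ) * q ^ (v : ℝ) * q ^ (w : ℝ) = q ^ (x : ℝ) * q ^ s := fun h => by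
    rw [← Real.rpow_natCast, ← Real.rpow_add hq0, ← Real.rpow_add hq0, ← Real.rpow_add hq0]
    exact congrArg _ (by exact_mod_cast h)
  have hmul : ∀ {u v w x s A B C D E : ℝ}, u * v * w = x * s →
      A * u * (B * v / D) * (C * w / E) = A * B * C * x * (s / (D * E)) := 
    fun {u v w x s A B C D E} h => by
      linear_combination (A * B * C * D⁻¹ * E⁻¹) * h
  refine hmul (hq ?_)
  rw [hp, hnat]
  exact hexp

theorem IsDurfeeSystem.sum_ucpf {Q a b : Fin L → Fin n → ℕ} (hDur : IsDurfeeSystem K Q a b)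
    (hsym : K.IsSymm) (hpd : (K.map (Nat.cast : ℕ → ℚ)).PosDef) (hq0 : 0 < q) (hq1 : q < 1)
    (hz : ∀ i, 0 < z i) :
    ∑ k, ENNReal.ofReal (ucpfCoeff (K.map (Nat.cast : ℕ → ℚ)) (Q k) (a k) (b k) z q) *
      (∑' m, ENNReal.ofReal (ucpfTerm (K.map (Nat.cast : ℕ → ℚ))
        (fun i => (Q k i : ℚ) + (b k i : ℚ)) (fun i => ∏ j, z j ^ (-(K i j : ℤ))) q m)) *
      (∑' m, ENNReal.ofReal (ucpfTerm (K.map (Nat.cast : ℕ → ℚ))⁻¹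
        (fun i => -(K.map (Nat.cast : ℕ → ℚ))⁻¹.mulVec (fun j => (Q k j : ℚ)) i + (a k i : ℚ))
        z q m)) =
    ENNReal.ofReal ((∏' j : ℕ, (1 - q ^ (j + 1))) ^ (-(n : ℤ))) *
      ∑' p, ENNReal.ofReal (thetaTerm (K.map (Nat.cast : ℕ → ℚ)) z q p) := by
  have hK : ∀ i, 0 < K i i := fun i => by simpa using hpd.diag_pos (i := i)
  have hz' : ∀ i, 0 < ∏ j, z j ^ (-(K i j : ℤ)) := fun i =>
    Finset.prod_pos fun j _ => zpow_pos (hz j) _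
  rw [← ENNReal.tsum_mul_left]
  have hlim : ∀ p, ENNReal.ofReal ((∏' j : ℕ, (1 - q ^ (j + 1))) ^ (-(n : ℤ))) *
      ENNReal.ofReal (thetaTerm (K.map (Nat.cast : ℕ → ℚ)) z q p) =
      ∑ k, ∑' m, ENNReal.ofReal (limitTerm K (Q k) (a k) (b k) q p m) *
        ENNReal.ofReal (thetaTerm (K.map (Nat.cast : ℕ → ℚ)) z q p) := fun p => by
    rw [← hDur.sum_limitTerm hK hq0 hq1 p, Finset.sum_mul]
    simp only [ENNReal.tsum_mul_right]
  rw [tsum_congr hlim, Summable.tsum_finsetSum fun _ _ => ENNReal.summable]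
  refine Finset.sum_congr rfl fun k _ => ?_
  rw [ENNReal.tsum_comm, mul_comm (ENNReal.ofReal _), ← ENNReal.tsum_mul_right,
    ← ENNReal.tsum_mul_right]
  refine tsum_congr fun m => ?_
  rw [← ENNReal.tsum_mul_left]
  have hinj : Function.Injective fun (m' : Fin n → ℕ) (i : Fin n) =>
      (m' i : ℤ) - (K.mulVec m i + Q k i : ℕ) := fun x y h => by
    ext i
    have := congrFun h i
    simpa using this
  rw [← hinj.tsum_eq]
  · refine tsum_congr fun m' => ?_
    rw [mul_comm (ENNReal.ofReal _) (ENNReal.ofReal (ucpfCoeff _ _ _ _ _ _)),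
      ← ENNReal.ofReal_mul (ucpfCoeff_nonneg _ _ _ _ hq0 hz),
      ← ENNReal.ofReal_mul (mul_nonneg (ucpfCoeff_nonneg _ _ _ _ hq0 hz)
        (ucpfTerm_nonneg _ _ hq0 hq1 hz' _)), ucpf_summand_eq hsym hpd _ _ _ hq0 hz, mul_comm,
      ENNReal.ofReal_mul (limitTerm_nonneg _ _ _ _ _ hq0 hq1 _)]
  · intro p hp
    have hnn : ∀ i, 0 ≤ ((K.mulVec m i + Q k i : ℕ) : ℤ) + p i := by
      by_contra h
      refine hp ?_
      dsimp only
      rw [limitTerm, if_neg h, ENNReal.ofReal_zero, zero_mul]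
    refine ⟨fun i => (((K.mulVec m i + Q k i : ℕ) : ℤ) + p i).toNat, ?_⟩
    ext i
    dsimp only
    rw [Int.toNat_of_nonneg (hnn i)]
    ring

end Character

/-- Let `K ∈ GL(n, ℤ≥0)` be symmetric positive definite with a Durfee
system `(Q k, a k, b k)`, let `q ∈ (0,1)` and `z₁, …, z_n > 0` be real, and set
`Q'⁽ᵏ⁾ := -K⁻¹·Q⁽ᵏ⁾`, `z'_i := ∏_j z_j^(-K_{ij})`.  Then
`Σ_k (∏_i z_i^(-Q_i)) q^{½ Q·K⁻¹·Q + a·b} Z_∞(K; Q+b | z'; q) Z_∞(K⁻¹; Q'+a | z; q)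
  = (∏_{j≥1} (1-q^j))^(-n) ⬝ Σ_{p ∈ ℤ^n} (∏_i z_i^{p_i}) q^{½ p·K⁻¹·p}`,
the series on the right converging absolutely since `K⁻¹` is positive definite. -/
theorem durfee_ucpf_character_identity {n L : ℕ} (K : Matrix (Fin n) (Fin n) ℕ)
    (hsym : K.IsSymm) (hpd : (K.map (Nat.cast : ℕ → ℚ)).PosDef)
    (Q a b : Fin L → Fin n → ℕ) (hDur : IsDurfeeSystem K Q a b)
    (q : ℝ) (hq0 : 0 < q) (hq1 : q < 1) (z : Fin n → ℝ) (hz : ∀ i, 0 < z i) :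
    ∑ k : Fin L,
      (∏ i, z i ^ (-(Q k i : ℤ))) *
      q ^ (((1 / 2) * ((fun i => (Q k i : ℚ)) ⬝ᵥ
          (K.map (Nat.cast : ℕ → ℚ))⁻¹.mulVec (fun i => (Q k i : ℚ))) +
        ∑ i, (a k i : ℚ) * (b k i : ℚ) : ℚ) : ℝ) *
      ZucpfInfty n (K.map (Nat.cast : ℕ → ℚ))
        (fun i => (Q k i : ℚ) + (b k i : ℚ))
        (fun i => ∏ j, z j ^ (-(K i j : ℤ))) q *
      ZucpfInfty n (K.map (Nat.cast : ℕ → ℚ))⁻¹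
        (fun i => -(K.map (Nat.cast : ℕ → ℚ))⁻¹.mulVec (fun j => (Q k j : ℚ)) i
          + (a k i : ℚ)) z q =
    (∏' j : ℕ, (1 - q ^ (j + 1))) ^ (-(n : ℤ)) *
      ∑' p : Fin n → ℤ,
        (∏ i, z i ^ p i) *
        q ^ ((((1 / 2) * ((fun i => (p i : ℚ)) ⬝ᵥ
          (K.map (Nat.cast : ℕ → ℚ))⁻¹.mulVec (fun i => (p i : ℚ)))) : ℚ) : ℝ) := by
  have hz' : ∀ i, 0 < ∏ j, z j ^ (-(K i j : ℤ)) := fun i =>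
    Finset.prod_pos fun j _ => zpow_pos (hz j) _
  have hmain := hDur.sum_ucpf hsym hpd hq0 hq1 hz
  have htop := ENNReal.mul_ne_top
    (ENNReal.ofReal_ne_top (r := (∏' j : ℕ, (1 - q ^ (j + 1))) ^ (-(n : ℤ))))
    (tsum_thetaTerm_ne_top hpd hq0 hq1 hz)
  rw [← hmain] at htop
  have hreal := congrArg ENNReal.toReal hmain
  rw [ENNReal.toReal_sum fun k hk => (ENNReal.sum_ne_top.1 htop) k hk] at hreal
  have hP : 0 ≤ ∏' j : ℕ, (1 - q ^ (j + 1)) :=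
    ge_of_tendsto' (tendsto_qPoch_self hq0 hq1) fun M => (qPoch_self_pos hq0 hq1 M).le
  simp only [ENNReal.toReal_mul, ENNReal.toReal_ofReal (zpow_nonneg hP _),
    ENNReal.toReal_ofReal (ucpfCoeff_nonneg _ _ _ _ hq0 hz),
    ← ZucpfInfty_eq_toReal _ _ hq0 hq1 hz, ← ZucpfInfty_eq_toReal _ _ hq0 hq1 hz',
    ENNReal.tsum_toReal_eq fun _ => ENNReal.ofReal_ne_top,
    ENNReal.toReal_ofReal (thetaTerm_nonneg hq0 hz _)] at hreal
  exact hreal
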